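/- Merkle update locality: for every Merkle tree t and address p with leafAt t p = some d, there exists a single sibling-hash list π with π.length = p.length such that combine (h₀ d) π = root t and, for every replacement datum d', combine (h₀ d') π = root (update t p d'). Hence the effect of replacing one leaf on the committed root is computed by recomputing only the affected branch, using the same sibling path. -/

import Mathlib

/-- A Merkle (binary) tree over a data type `D`. -/
inductive BTree (D : Type*) where
  | leaf (d : D)
  | node (l r : BTree D)

/-- The Merkle root of a tree, given a leaf hash `h₀` and a combiner `h`. -/
def BTree.root {D α : Type*} (h₀ : D → α) (h : α → α → α) : BTree D → α
  | .leaf d => h₀ d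
  | .node l r => h (l.root h₀ h) (r.root h₀ h)

/-- The leaf addressed by a list of booleans, if any. -/
def BTree.leafAt {D : Type*} : BTree D → List Bool → Option D
  | .leaf d, [] => some d
  | .node l _, false :: p => l.leafAt p
  | .node _ r, true :: p => r.leafAt p
  | _, _ => none

/-- Fold a claimed leaf hash up a sibling path. -/
def combine {α : Type*} (h : α → α → α) : α → List (Bool × α) → α
  | a, [] => a
  | a, (b, s) :: rest => combine h (if b then h s a else h a s) rest

/-- Replace the leaf addressed by `p` with `leaf d'` (no change if `p`
addresses no leaf). -/
def BTree.update {D : Type*} : BTree D → List Bool → D → BTree D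
  | .leaf _, [], d' => .leaf d'
  | .node l r, false :: p, d' => .node (l.update p d') r
  | .node l r, true :: p, d' => .node l (r.update p d')
  | t, _, _ => t

theorem combine_append {α : Type*} (h : α → α → α) (a : α) (π ρ : List (Bool × α)) :
    combine h a (π ++ ρ) = combine h (combine h a π) ρ := by
  induction π generalizing a with
  | nil => rfl
  | cons x π ih => exact ih _

/-- Merkle update locality: for a tree `t` and address `p` holding
datum `d`, there is a single sibling-hash list `π` of length `p.length` with
`combine (h₀ d) π = root t` and, for every replacement `d'`,
`combine (h₀ d') π = root (update t p d')`. -/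
theorem stmt_9
    {D α : Type*} (h₀ : D → α) (h : α → α → α)
    (t : BTree D) (p : List Bool) (d : D)
    (hleaf : t.leafAt p = some d) :
    ∃ π : List (Bool × α), π.length = p.length ∧
      combine h (h₀ d) π = t.root h₀ h ∧
      ∀ d' : D, combine h (h₀ d') π = (t.update p d').root h₀ h := by
  induction t generalizing p with
  | leaf e =>
    cases p with
    | nil =>
      obtain rfl : e = d := Option.some.inj hleaf
      exact ⟨[], rfl, rfl, fun _ => rfl⟩
    | cons b p => simp [BTree.leafAt] at hleaf
  | node l r ihl ihr =>
    match p, hleaf with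
    | [], hleaf => simp [BTree.leafAt] at hleaf
    | false :: p, hleaf =>
      obtain ⟨π, hlen, hroot, hupd⟩ := ihl p hleaf
      refine ⟨π ++ [(false, r.root h₀ h)], by simp [hlen], ?_, fun d' => ?_⟩
      · simp [combine_append, hroot, combine, BTree.root]
      · simp [combine_append, hupd, combine, BTree.root, BTree.update]
    | true :: p, hleaf =>
      obtain ⟨π, hlen, hroot, hupd⟩ := ihr p hleaf
      refine ⟨π ++ [(true, l.root h₀ h)], by simp [hlen], ?_, fun d' => ?_⟩
      · simp [combine_append, hroot, combine, BTree.root]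
      · simp [combine_append, hupd, combine, BTree.root, BTree.update]
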